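/- arXiv:1806.06932 — 2 statements merged into one kernel-verified Lean document; each statement's English description precedes it below -/
import Mathlib

section
/- Let G be a weak near-triangulation and let B be a block of G. Then B is either a near-triangulation or a K_2 (a block consisting of a single edge). -/
open Set

/-- A plane graph: a finite simple graph whose vertices are points of the plane,
together with a plane embedding in which every edge is drawn as an arc (the range of an
injective path) joining its endpoints, two arcs meet only in common endpoints, and
no vertex lies on an arc other than at its endpoints. -/
structure PlaneGraph where
  verts : Set (ℝ × ℝ)
  finite_verts : verts.Finite
  Adj : (ℝ × ℝ) → (ℝ × ℝ) → Prop
  adj_symm : ∀ u v, Adj u v → Adj v u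
  adj_irrefl : ∀ v, ¬ Adj v v
  adj_mem : ∀ u v, Adj u v → u ∈ verts
  arc : (ℝ × ℝ) → (ℝ × ℝ) → Set (ℝ × ℝ)
  arc_symm : ∀ u v, arc u v = arc v u
  arc_path : ∀ u v, Adj u v → ∃ γ : Path u v, Function.Injective ⇑γ ∧ arc u v = Set.range ⇑γ
  arc_verts : ∀ u v, Adj u v → verts ∩ arc u v ⊆ {u, v}
  arc_inter : ∀ u v u' v', Adj u v → Adj u' v' → ({u, v} : Set (ℝ × ℝ)) ≠ {u', v'} →
    arc u v ∩ arc u' v' ⊆ ({u, v} : Set (ℝ × ℝ)) ∩ {u', v'}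

namespace PlaneGraph

/-- The plane subgraph induced on a set of vertices, with the inherited embedding. -/
def induce (G : PlaneGraph) (S : Set (ℝ × ℝ)) : PlaneGraph where
  verts := G.verts ∩ S
  finite_verts := G.finite_verts.subset inter_subset_left
  Adj u v := G.Adj u v ∧ u ∈ S ∧ v ∈ S
  adj_symm _ _ h := ⟨G.adj_symm _ _ h.1, h.2.2, h.2.1⟩
  adj_irrefl v h := G.adj_irrefl v h.1
  adj_mem _ _ h := ⟨G.adj_mem _ _ h.1, h.2.1⟩
  arc := G.arc
  arc_symm := G.arc_symm
  arc_path _ _ h := G.arc_path _ _ h.1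
  arc_verts _ _ h := fun _ hx => G.arc_verts _ _ h.1 ⟨hx.1.1, hx.2⟩
  arc_inter _ _ _ _ h h' hne := G.arc_inter _ _ _ _ h.1 h'.1 hne

/-- Deleting a set of vertices (together with all incident edges),
keeping the inherited embedding. -/
def delete (G : PlaneGraph) (X : Set (ℝ × ℝ)) : PlaneGraph := G.induce Xᶜ

/-- Deleting a single vertex. -/
def erase (G : PlaneGraph) (x : ℝ × ℝ) : PlaneGraph := G.delete {x}

/-- The point set of the plane drawing of `G`. -/
def drawing (G : PlaneGraph) : Set (ℝ × ℝ) :=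
  G.verts ∪ ⋃ (u) (v) (_ : G.Adj u v), G.arc u v

/-- The faces of `G`: connected components of the complement of the drawing. -/
def IsFace (G : PlaneGraph) (F : Set (ℝ × ℝ)) : Prop :=
  ∃ x, x ∉ G.drawing ∧ F = connectedComponentIn G.drawingᶜ x

/-- A vertex is external if it is incident to (i.e. lies on the boundary of)
an unbounded face. -/
def ExternalVertex (G : PlaneGraph) (v : ℝ × ℝ) : Prop :=
  v ∈ G.verts ∧ ∃ F, G.IsFace F ∧ ¬ Bornology.IsBounded F ∧ v ∈ closure F

/-- A triangle (cycle on three vertices) of `G`. -/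
def IsTriangle (G : PlaneGraph) (a b c : ℝ × ℝ) : Prop :=
  a ≠ b ∧ a ≠ c ∧ b ≠ c ∧ G.Adj a b ∧ G.Adj b c ∧ G.Adj a c

/-- `v` is contained in a triangle of `G`. -/
def InTriangle (G : PlaneGraph) (v : ℝ × ℝ) : Prop := ∃ b c, G.IsTriangle v b c

/-- The drawing of the closed curve formed by a triangle on `a`, `b`, `c`. -/
def triDrawing (G : PlaneGraph) (a b c : ℝ × ℝ) : Set (ℝ × ℝ) :=
  G.arc a b ∪ G.arc b c ∪ G.arc a c

/-- A face is triangular if its boundary is the drawing of a triangle of `G`. -/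
def IsTriangularFace (G : PlaneGraph) (F : Set (ℝ × ℝ)) : Prop :=
  ∃ a b c, G.IsTriangle a b c ∧ frontier F = G.triDrawing a b c

/-- The interior region of the closed curve drawn by a triangle: the union of the
bounded connected components of the complement of its drawing. -/
def triangleInterior (G : PlaneGraph) (a b c : ℝ × ℝ) : Set (ℝ × ℝ) :=
  {x | x ∉ G.triDrawing a b c ∧
    Bornology.IsBounded (connectedComponentIn (G.triDrawing a b c)ᶜ x)}

/-- A facial triangle: a triangle whose interior region is a face of `G`. -/
def IsFacialTriangle (G : PlaneGraph) (a b c : ℝ × ℝ) : Prop :=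
  G.IsTriangle a b c ∧ G.IsFace (G.triangleInterior a b c)

/-- A weak near-triangulation: every bounded face is triangular and every vertex
is contained in a triangle. -/
def IsWNT (G : PlaneGraph) : Prop :=
  (∀ F, G.IsFace F → Bornology.IsBounded F → G.IsTriangularFace F) ∧
  ∀ v ∈ G.verts, G.InTriangle v

/-- Reachability by walks in `G`. -/
def Reachable (G : PlaneGraph) (u v : ℝ × ℝ) : Prop := Relation.ReflTransGen G.Adj u v

/-- Connectedness of `G`. -/
def Connected (G : PlaneGraph) : Prop :=
  G.verts.Nonempty ∧ ∀ u ∈ G.verts, ∀ v ∈ G.verts, G.Reachable u v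

/-- A cutvertex: a vertex whose deletion separates two other vertices. -/
def IsCutvertex (G : PlaneGraph) (v : ℝ × ℝ) : Prop :=
  v ∈ G.verts ∧ ∃ a b, a ∈ G.verts ∧ b ∈ G.verts ∧ a ≠ v ∧ b ≠ v ∧
    G.Reachable a b ∧ ¬ (G.erase v).Reachable a b

/-- 2-connectivity: connected, on at least three vertices, with no cutvertex. -/
def TwoConnected (G : PlaneGraph) : Prop :=
  G.Connected ∧ 3 ≤ G.verts.ncard ∧ ∀ v, ¬ G.IsCutvertex v

/-- A near-triangulation: a 2-connected plane graph all of whose bounded faces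
are triangular. -/
def IsNearTriangulation (G : PlaneGraph) : Prop :=
  G.TwoConnected ∧ ∀ F, G.IsFace F → Bornology.IsBounded F → G.IsTriangularFace F

/-- A plane triangulation: a connected plane graph all of whose faces (including
the unbounded one) are triangular. -/
def IsTriangulation (G : PlaneGraph) : Prop :=
  G.Connected ∧ ∀ F, G.IsFace F → G.IsTriangularFace F

/-- A block of `G`, given by its vertex set `B`: a maximal set of vertices inducing
a connected subgraph without a cutvertex. -/
def IsBlock (G : PlaneGraph) (B : Set (ℝ × ℝ)) : Prop :=
  B ⊆ G.verts ∧ (G.induce B).Connected ∧ (∀ v, ¬ (G.induce B).IsCutvertex v) ∧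
  ∀ B', B ⊆ B' → B' ⊆ G.verts → (G.induce B').Connected →
    (∀ v, ¬ (G.induce B').IsCutvertex v) → B' = B

/-- A plane graph is outerplanar if all of its vertices are incident to the
unbounded face. -/
def IsOuterplanar (G : PlaneGraph) : Prop := ∀ v ∈ G.verts, G.ExternalVertex v

/-- A dominating set of `G`. -/
def IsDominatingSet (G : PlaneGraph) (D : Set (ℝ × ℝ)) : Prop :=
  D ⊆ G.verts ∧ ∀ v ∈ G.verts, v ∉ D → ∃ d ∈ D, G.Adj v d

/-- The domination number of `G`. -/
noncomputable def dominationNumber (G : PlaneGraph) : ℕ :=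
  sInf {n | ∃ D, G.IsDominatingSet D ∧ D.ncard = n}

/-- `u` is problematic in `G` if `G − u` is not a weak near-triangulation. -/
def Problematic (G : PlaneGraph) (u : ℝ × ℝ) : Prop := ¬ (G.erase u).IsWNT

/-- `x` is a `u`-bad vertex in `G`: a vertex of `G − u` not contained in a triangle
of `G − u`. -/
def IsBadFor (G : PlaneGraph) (u x : ℝ × ℝ) : Prop :=
  x ∈ G.verts ∧ x ≠ u ∧ ¬ (G.erase u).InTriangle x

end PlaneGraph

section Topology

theorem one_lt_rank_plane : 1 < Module.rank ℝ (ℝ × ℝ) := by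
  rw [rank_prod', Module.rank_self]
  norm_num

/-- A preconnected set that meets `F` but not its frontier lies in `F`. -/
theorem IsPreconnected.subset_of_disjoint_frontier {X : Type*} [TopologicalSpace X]
    {N F : Set X} (hN : IsPreconnected N) (hne : (N ∩ F).Nonempty)
    (hd : Disjoint N (frontier F)) : N ⊆ F := by
  have hcov : N ⊆ interior F ∪ interior Fᶜ := by
    intro x hx
    have h := Set.disjoint_left.1 hd hx
    by_contra hcon
    simp only [mem_union, not_or, interior_compl, mem_compl_iff, not_not] at hcon
    exact h ⟨hcon.2, hcon.1⟩
  have hdisj : Disjoint (interior F) (interior Fᶜ) :=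
    Set.disjoint_left.2 fun x hx hx' => interior_subset hx' (interior_subset hx)
  obtain ⟨x, hxN, hxF⟩ := hne
  have hxi : x ∈ interior F := (hcov hxN).resolve_right fun h => interior_subset h hxF
  exact (hN.subset_left_of_subset_union isOpen_interior isOpen_interior hdisj hcov
    ⟨x, hxN, hxi⟩).trans interior_subset

/-- If all members of a family have their frontiers in a closed set `D`, then the closure of the
union of the family adds at most points of `D`. -/
theorem closure_sUnion_subset_of_frontier_subset {X : Type*} [TopologicalSpace X]
    [LocallyConnectedSpace X] {S : Set (Set X)} {D : Set X} (hD : IsClosed D)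
    (hS : ∀ F ∈ S, frontier F ⊆ D) : closure (⋃₀ S) ⊆ ⋃₀ S ∪ D := by
  intro x hx
  by_cases hxD : x ∈ D
  · exact Or.inr hxD
  have hN : IsOpen (connectedComponentIn Dᶜ x) := hD.isOpen_compl.connectedComponentIn
  obtain ⟨y, hyN, F, hFS, hyF⟩ := mem_closure_iff.1 hx _ hN (mem_connectedComponentIn hxD)
  refine Or.inl ⟨F, hFS, ?_⟩
  refine IsPreconnected.subset_of_disjoint_frontier isPreconnected_connectedComponentIn
    ⟨y, hyN, hyF⟩ ?_ (mem_connectedComponentIn hxD)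
  exact Set.disjoint_left.2 fun z hz hzF =>
    connectedComponentIn_subset _ _ hz (hS F hFS hzF)

/-- An arc has empty interior in the plane. -/
theorem interior_range_eq_empty_of_injective {γ : unitInterval → ℝ × ℝ} (hc : Continuous γ)
    (hi : Function.Injective γ) : interior (range γ) = ∅ := by
  rw [Set.eq_empty_iff_forall_notMem]
  intro y hy
  obtain ⟨r, hr, hball⟩ := Metric.isOpen_iff.1 isOpen_interior y hy
  have hemb : Topology.IsEmbedding γ := (hc.isClosedEmbedding hi).isEmbedding
  let g : ℝ × ℝ → ℝ × ℝ := fun x =>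
    y + r • ((Homeomorph.unitBall x : Metric.ball (0 : ℝ × ℝ) 1) : ℝ × ℝ)
  have hgc : Continuous g := by fun_prop
  have hgi : Function.Injective g := fun a b hab =>
    Homeomorph.unitBall.injective (Subtype.ext (smul_right_injective _ hr.ne' (add_left_cancel hab)))
  have hgr : ∀ x, g x ∈ range γ := by
    intro x
    refine interior_subset (hball ?_)
    have h := (Homeomorph.unitBall x : Metric.ball (0 : ℝ × ℝ) 1).2
    rw [mem_ball_zero_iff] at h
    rw [Metric.mem_ball, dist_eq_norm, add_sub_cancel_left, norm_smul, Real.norm_of_nonneg hr.le]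
    exact mul_lt_of_lt_one_right hr h
  have hpre : ∀ A : Set (ℝ × ℝ), IsPreconnected A → (γ ⁻¹' (g '' A)).OrdConnected := by
    intro A hA
    rw [← isPreconnected_iff_ordConnected, ← hemb.isInducing.isPreconnected_image,
      Set.image_preimage_eq_of_subset]
    · exact hA.image _ hgc.continuousOn
    · rintro _ ⟨x, -, rfl⟩
      exact hgr x
  have key : ∀ a c : unitInterval, a < c → γ a ∈ range g → γ c ∈ range g → False := by
    rintro a c hac ⟨u, hu⟩ ⟨w, hw⟩
    obtain ⟨b, hab, hbc⟩ := exists_between hac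
    obtain ⟨v, -, hv⟩ := (hpre univ isPreconnected_univ).out (x := a) ⟨u, trivial, hu⟩
      (y := c) ⟨w, trivial, hw⟩ ⟨hab.le, hbc.le⟩
    have hcon := hpre {v}ᶜ (isConnected_compl_singleton_of_one_lt_rank
      one_lt_rank_plane v).isPreconnected
    have huv : u ≠ v := fun h => hab.ne (hi (hu.symm.trans (h ▸ hv)))
    have hwv : w ≠ v := fun h => hbc.ne (hi (hv.symm.trans (h ▸ hw)))
    obtain ⟨v', hv', hvv⟩ := hcon.out (x := a) ⟨u, huv, hu⟩ (y := c) ⟨w, hwv, hw⟩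
      ⟨hab.le, hbc.le⟩
    exact hv' (hgi (hvv.trans hv.symm))
  obtain ⟨a, ha⟩ := hgr 0
  obtain ⟨c, hc'⟩ := hgr (1, 0)
  rcases lt_trichotomy a c with h | h | h
  · exact key a c h ⟨_, ha.symm⟩ ⟨_, hc'.symm⟩
  · subst h
    have h0 := hgi (ha.symm.trans hc')
    simp [Prod.ext_iff] at h0
  · exact key c a h ⟨_, hc'.symm⟩ ⟨_, ha.symm⟩

/-- The frontier of a nonempty bounded open set in the plane is infinite. -/
theorem infinite_frontier_of_isBounded {F : Set (ℝ × ℝ)} (hF : IsOpen F) (hne : F.Nonempty)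
    (hb : Bornology.IsBounded F) : (frontier F).Infinite := by
  intro hfin
  have hcon := (hfin.countable.isConnected_compl_of_one_lt_rank one_lt_rank_plane).isPreconnected
  obtain ⟨x, hx⟩ := hne
  have hx' : x ∈ (frontier F)ᶜ := fun h => by
    rw [hF.frontier_eq] at h
    exact h.2 hx
  have hsub := IsPreconnected.subset_of_disjoint_frontier hcon ⟨x, hx', hx⟩ disjoint_compl_left
  refine NormedSpace.unbounded_univ ℝ (ℝ × ℝ) ((hb.union hfin.isBounded).subset fun y _ => ?_)
  by_cases hy : y ∈ frontier F
  · exact Or.inr hy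
  · exact Or.inl (hsub hy)

end Topology

namespace PlaneGraph

section Drawing

variable (G : PlaneGraph)

theorem finite_edges : {e : (ℝ × ℝ) × (ℝ × ℝ) | G.Adj e.1 e.2}.Finite :=
  (G.finite_verts.prod G.finite_verts).subset fun _ he =>
    ⟨G.adj_mem _ _ he, G.adj_mem _ _ (G.adj_symm _ _ he)⟩

variable {G}

theorem isClosed_arc {u v : ℝ × ℝ} (h : G.Adj u v) : IsClosed (G.arc u v) := by
  obtain ⟨γ, -, hγ⟩ := G.arc_path u v h
  rw [hγ]
  exact (isCompact_range γ.continuous).isClosed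

theorem dense_compl_arc {u v : ℝ × ℝ} (h : G.Adj u v) : Dense (G.arc u v)ᶜ := by
  obtain ⟨γ, hi, hγ⟩ := G.arc_path u v h
  rw [← interior_eq_empty_iff_dense_compl, hγ]
  exact interior_range_eq_empty_of_injective γ.continuous hi

theorem arc_subset_drawing {u v : ℝ × ℝ} (h : G.Adj u v) : G.arc u v ⊆ G.drawing :=
  fun _ hx => Or.inr (mem_iUnion₂.2 ⟨u, v, mem_iUnion.2 ⟨h, hx⟩⟩)

theorem mem_drawing {x : ℝ × ℝ} :
    x ∈ G.drawing ↔ x ∈ G.verts ∨ ∃ u v, G.Adj u v ∧ x ∈ G.arc u v := by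
  simp [drawing]

theorem drawing_eq : G.drawing =
    G.verts ∪ ⋃ e ∈ {e : (ℝ × ℝ) × (ℝ × ℝ) | G.Adj e.1 e.2}, G.arc e.1 e.2 := by
  ext x
  simp [drawing]

theorem isClosed_drawing (G : PlaneGraph) : IsClosed G.drawing := by
  rw [drawing_eq]
  exact G.finite_verts.isClosed.union (G.finite_edges.isClosed_biUnion fun _ he => isClosed_arc he)

theorem dense_compl_drawing (G : PlaneGraph) : Dense G.drawingᶜ := by
  rw [drawing_eq, compl_union, compl_iUnion₂]
  refine Dense.inter_of_isOpen_left (G.finite_verts.countable.dense_compl ℝ) ?_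
    G.finite_verts.isClosed.isOpen_compl
  exact dense_biInter_of_isOpen (fun _ he => (isClosed_arc he).isOpen_compl)
    G.finite_edges.countable fun _ he => dense_compl_arc he

theorem IsFace.isOpen {F : Set (ℝ × ℝ)} (h : G.IsFace F) : IsOpen F := by
  obtain ⟨x, -, rfl⟩ := h
  exact G.isClosed_drawing.isOpen_compl.connectedComponentIn

theorem IsFace.isPreconnected {F : Set (ℝ × ℝ)} (h : G.IsFace F) : IsPreconnected F := by
  obtain ⟨x, -, rfl⟩ := h
  exact isPreconnected_connectedComponentIn

theorem IsFace.nonempty {F : Set (ℝ × ℝ)} (h : G.IsFace F) : F.Nonempty := by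
  obtain ⟨x, hx, rfl⟩ := h
  exact ⟨x, mem_connectedComponentIn hx⟩

theorem IsFace.disjoint_drawing {F : Set (ℝ × ℝ)} (h : G.IsFace F) : Disjoint F G.drawing := by
  obtain ⟨x, -, rfl⟩ := h
  exact Set.disjoint_left.2 fun z hz => connectedComponentIn_subset _ _ hz

theorem IsFace.frontier_subset {F : Set (ℝ × ℝ)} (h : G.IsFace F) : frontier F ⊆ G.drawing := by
  intro y hy
  by_contra hyd
  have hN : IsOpen (connectedComponentIn G.drawingᶜ y) :=
    G.isClosed_drawing.isOpen_compl.connectedComponentIn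
  obtain ⟨z, hzN, hzF⟩ := mem_closure_iff.1 hy.1 _ hN (mem_connectedComponentIn hyd)
  have hyF : y ∉ F := fun hyF => by
    rw [h.isOpen.frontier_eq] at hy
    exact hy.2 hyF
  obtain ⟨x, -, rfl⟩ := h
  rw [connectedComponentIn_eq hzF, ← connectedComponentIn_eq hzN] at hyF
  exact hyF (mem_connectedComponentIn hyd)

theorem induce_drawing_subset (B : Set (ℝ × ℝ)) : (G.induce B).drawing ⊆ G.drawing := by
  intro x hx
  rcases mem_drawing.1 hx with h | ⟨u, v, h, hx⟩
  · exact Or.inl h.1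
  · exact arc_subset_drawing (G := G) h.1 hx

/-- A bounded face of an induced subgraph is triangular, if all bounded faces of the whole graph
are triangular and every triangle that has two vertices in the subgraph lies in the subgraph. -/
theorem isTriangularFace_induce {B : Set (ℝ × ℝ)}
    (hG : ∀ F, G.IsFace F → Bornology.IsBounded F → G.IsTriangularFace F)
    (hB : ∀ a ∈ B, ∀ b ∈ B, ∀ c, a ≠ b → G.Adj a c → G.Adj b c → c ∈ B)
    {F : Set (ℝ × ℝ)} (hF : (G.induce B).IsFace F) (hb : Bornology.IsBounded F) :
    (G.induce B).IsTriangularFace F := by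
  have hsub : ∀ x ∈ F, x ∉ G.drawing → connectedComponentIn G.drawingᶜ x ⊆ F := by
    intro x hxF hx
    refine IsPreconnected.subset_of_disjoint_frontier isPreconnected_connectedComponentIn
      ⟨x, mem_connectedComponentIn hx, hxF⟩ ?_
    exact Set.disjoint_left.2 fun z hz hzF =>
      connectedComponentIn_subset _ _ hz (induce_drawing_subset B (hF.frontier_subset hzF))
  by_cases hex : ∃ F', G.IsFace F' ∧ F' ⊆ F ∧ ∃ a b c, a ∈ B ∧ b ∈ B ∧ c ∈ B ∧
      G.IsTriangle a b c ∧ frontier F' = G.triDrawing a b c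
  · obtain ⟨F', hF', hF'F, a, b, c, ha, hb', hc, ht, hfr⟩ := hex
    obtain ⟨hab, hac, hbc, eab, ebc, eac⟩ := ht
    have ht' : (G.induce B).IsTriangle a b c :=
      ⟨hab, hac, hbc, ⟨eab, ha, hb'⟩, ⟨ebc, hb', hc⟩, ⟨eac, ha, hc⟩⟩
    have hfrd : frontier F' ⊆ (G.induce B).drawing := by
      rw [hfr]
      refine union_subset (union_subset ?_ ?_) ?_
      · exact arc_subset_drawing ht'.2.2.2.1
      · exact arc_subset_drawing ht'.2.2.2.2.1
      · exact arc_subset_drawing ht'.2.2.2.2.2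
    obtain ⟨x, hx⟩ := hF'.nonempty
    have hFF' : F ⊆ F' := hF.isPreconnected.subset_of_disjoint_frontier ⟨x, hF'F hx, hx⟩
      (hF.disjoint_drawing.mono_right hfrd)
    exact ⟨a, b, c, ht', by rw [hFF'.antisymm hF'F, hfr]; rfl⟩
  · exfalso
    set E : Set ((ℝ × ℝ) × (ℝ × ℝ)) := {e | G.Adj e.1 e.2 ∧ ¬ (e.1 ∈ B ∧ e.2 ∈ B)} with hE
    set D : Set (ℝ × ℝ) := ⋃ e ∈ E, G.arc e.1 e.2 with hDdef
    have hD : IsClosed D :=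
      (G.finite_edges.subset fun e he => he.1).isClosed_biUnion fun e he => isClosed_arc he.1
    have harc : ∀ u v, G.Adj u v → ¬ (u ∈ B ∧ v ∈ B) → G.arc u v ⊆ D := fun u v h h' x hx =>
      mem_biUnion (x := (u, v)) (show (u, v) ∈ E from ⟨h, h'⟩) hx
    have hS : ∀ F' ∈ {F' | G.IsFace F' ∧ F' ⊆ F}, frontier F' ⊆ D := by
      rintro F' ⟨hF', hF'F⟩
      obtain ⟨a, b, c, ht, hfr⟩ := hG F' hF' (hb.subset hF'F)
      have hnot : ¬ (a ∈ B ∧ b ∈ B ∧ c ∈ B) := fun h =>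
        hex ⟨F', hF', hF'F, a, b, c, h.1, h.2.1, h.2.2, ht, hfr⟩
      obtain ⟨hab, hac, hbc, eab, ebc, eac⟩ := ht
      have h1 : ¬ (a ∈ B ∧ b ∈ B) := fun h => hnot ⟨h.1, h.2, hB a h.1 b h.2 c hab eac ebc⟩
      have h2 : ¬ (b ∈ B ∧ c ∈ B) := fun h =>
        hnot ⟨hB b h.1 c h.2 a hbc (G.adj_symm _ _ eab) (G.adj_symm _ _ eac), h⟩
      have h3 : ¬ (a ∈ B ∧ c ∈ B) := fun h =>
        hnot ⟨h.1, hB a h.1 c h.2 b hac eab (G.adj_symm _ _ ebc), h.2⟩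
      rw [hfr]
      exact union_subset (union_subset (harc _ _ eab h1) (harc _ _ ebc h2)) (harc _ _ eac h3)
    refine infinite_frontier_of_isBounded hF.isOpen hF.nonempty hb
      (G.finite_verts.subset fun x hx => ?_)
    have hxF : x ∉ F := fun h => by
      rw [hF.isOpen.frontier_eq] at hx
      exact hx.2 h
    have hxcl : x ∈ closure (⋃₀ {F' | G.IsFace F' ∧ F' ⊆ F}) := by
      have h1 : F ⊆ closure (F ∩ G.drawingᶜ) :=
        G.dense_compl_drawing.open_subset_closure_inter hF.isOpen
      refine closure_mono ?_ (closure_minimal h1 isClosed_closure hx.1)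
      rintro z ⟨hzF, hz⟩
      exact ⟨_, ⟨⟨z, hz, rfl⟩, hsub z hzF hz⟩, mem_connectedComponentIn hz⟩
    rcases closure_sUnion_subset_of_frontier_subset hD hS hxcl with ⟨F', hF', hxF'⟩ | hxD
    · exact absurd (hF'.2 hxF') hxF
    · obtain ⟨⟨u, v⟩, he, hxuv⟩ := mem_iUnion₂.1 hxD
      rcases mem_drawing.1 (hF.frontier_subset hx) with h | ⟨u', v', h, hx'⟩
      · exact h.1
      · have hne : ({u, v} : Set (ℝ × ℝ)) ≠ {u', v'} := by
          intro heq
          refine he.2 ⟨?_, ?_⟩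
          · have : u ∈ ({u', v'} : Set (ℝ × ℝ)) := heq ▸ mem_insert u {v}
            rcases this with h' | h' <;> rw [h']
            exacts [h.2.1, h.2.2]
          · have : v ∈ ({u', v'} : Set (ℝ × ℝ)) := heq ▸ mem_insert_of_mem u rfl
            rcases this with h' | h' <;> rw [h']
            exacts [h.2.1, h.2.2]
        rcases (G.arc_inter u v u' v' he.1 h.1 hne ⟨hxuv, hx'⟩).1 with h' | h' <;> rw [h']
        exacts [G.adj_mem _ _ he.1, G.adj_mem _ _ (G.adj_symm _ _ he.1)]

end Drawing

section Blocks

variable {G : PlaneGraph}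

theorem Reachable.symm {u v : ℝ × ℝ} (h : G.Reachable u v) : G.Reachable v u := by
  induction h with
  | refl => exact Relation.ReflTransGen.refl
  | tail _ h ih => exact Relation.ReflTransGen.head (G.adj_symm _ _ h) ih

theorem Reachable.induce_mono {S T : Set (ℝ × ℝ)} (hST : S ⊆ T) {u v : ℝ × ℝ}
    (h : (G.induce S).Reachable u v) : (G.induce T).Reachable u v :=
  Relation.ReflTransGen.mono (fun _ _ h => ⟨h.1, hST h.2.1, hST h.2.2⟩) _ _ h

theorem Reachable.erase_mono {S T : Set (ℝ × ℝ)} (hST : S ⊆ T) {u v w : ℝ × ℝ}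
    (h : ((G.induce S).erase w).Reachable u v) : ((G.induce T).erase w).Reachable u v :=
  Relation.ReflTransGen.mono (fun _ _ h => ⟨⟨h.1.1, hST h.1.2.1, hST h.1.2.2⟩, h.2⟩) _ _ h

theorem Reachable.erase_of_notMem {S : Set (ℝ × ℝ)} {u v w : ℝ × ℝ} (hw : w ∉ S)
    (h : (G.induce S).Reachable u v) : ((G.induce S).erase w).Reachable u v :=
  Relation.ReflTransGen.mono (fun _ _ h => ⟨h, fun hp => hw (hp ▸ h.2.1), fun hq =>
    hw (hq ▸ h.2.2)⟩) _ _ h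

/-- A triangle with two vertices in a block is contained in the block. -/
theorem IsBlock.mem_of_adj_of_adj {B : Set (ℝ × ℝ)} (hB : G.IsBlock B) {a b c : ℝ × ℝ}
    (ha : a ∈ B) (hb : b ∈ B) (hab : a ≠ b) (hac : G.Adj a c) (hbc : G.Adj b c) : c ∈ B := by
  obtain ⟨hBG, hcon, hcut, hmax⟩ := hB
  by_contra hc
  have hcG : c ∈ G.verts := G.adj_mem _ _ (G.adj_symm _ _ hac)
  have hsub : B ⊆ insert c B := subset_insert c B
  have hBB : ∀ x ∈ B, ∀ y ∈ B, (G.induce B).Reachable x y := fun x hx y hy =>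
    hcon.2 x ⟨hBG hx, hx⟩ y ⟨hBG hy, hy⟩
  refine hc ((hmax (insert c B) hsub (insert_subset hcG hBG) ⟨⟨c, hcG, mem_insert c B⟩, ?_⟩ ?_) ▸
    mem_insert c B)
  · have key : ∀ x ∈ (G.induce (insert c B)).verts, (G.induce (insert c B)).Reachable x a := by
      rintro x ⟨-, rfl | hx⟩
      · exact Relation.ReflTransGen.single ⟨G.adj_symm _ _ hac, mem_insert _ _, hsub ha⟩
      · exact (hBB x hx a ha).induce_mono hsub
    exact fun u hu v hv => (key u hu).trans (key v hv).symm
  · rintro w ⟨-, x, y, ⟨-, hx⟩, ⟨-, hy⟩, hxw, hyw, -, hnot⟩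
    have hBw : ∀ x ∈ B, ∀ y ∈ B, x ≠ w → y ≠ w →
        ((G.induce (insert c B)).erase w).Reachable x y := by
      intro x hx y hy hxw hyw
      refine Reachable.erase_mono hsub ?_
      by_cases hw : w ∈ B
      · by_contra h
        exact hcut w ⟨⟨hBG hw, hw⟩, x, y, ⟨hBG hx, hx⟩, ⟨hBG hy, hy⟩, hxw, hyw,
          hBB x hx y hy, h⟩
      · exact (hBB x hx y hy).erase_of_notMem hw
    obtain ⟨d, hd, hdw, hdc⟩ : ∃ d ∈ B, d ≠ w ∧ G.Adj d c := by
      by_cases haw : a = w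
      · exact ⟨b, hb, fun h => hab (haw.trans h.symm), hbc⟩
      · exact ⟨a, ha, haw, hac⟩
    have key : ∀ x ∈ insert c B, x ≠ w → ((G.induce (insert c B)).erase w).Reachable x d := by
      rintro x (rfl | hx) hxw
      · exact Relation.ReflTransGen.single
          ⟨⟨G.adj_symm _ _ hdc, mem_insert _ _, hsub hd⟩, hxw, hdw⟩
      · exact hBw x hx d hd hxw hdw
    exact hnot ((key x hx hxw).trans (key y hy hyw).symm)

/-- A block containing an endpoint of an edge is not a singleton. -/
theorem IsBlock.ne_singleton {B : Set (ℝ × ℝ)} (hB : G.IsBlock B) {u v : ℝ × ℝ}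
    (h : G.Adj u v) : B ≠ {u} := by
  rintro rfl
  have huv : u ≠ v := fun e => G.adj_irrefl v (e ▸ h)
  have hu := G.adj_mem _ _ h
  have hv := G.adj_mem _ _ (G.adj_symm _ _ h)
  have hv' : v ∈ ({u, v} : Set (ℝ × ℝ)) := mem_insert_of_mem u rfl
  have hr : (G.induce {u, v}).Reachable u v :=
    Relation.ReflTransGen.single ⟨h, mem_insert u _, hv'⟩
  have heq := hB.2.2.2 {u, v} (by simp) (by simp [insert_subset_iff, hu, hv])
    ⟨⟨u, hu, mem_insert u _⟩, ?_⟩ ?_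
  · rw [heq] at hv'
    exact huv hv'.symm
  · rintro x ⟨-, rfl | rfl⟩ y ⟨-, rfl | rfl⟩
    exacts [Relation.ReflTransGen.refl, hr, hr.symm, Relation.ReflTransGen.refl]
  · rintro w ⟨⟨-, hw⟩, x, y, ⟨-, hx⟩, ⟨-, hy⟩, hxw, hyw, -, hnot⟩
    have hxy : x = y := by
      simp only [mem_insert_iff, mem_singleton_iff] at hw hx hy
      grind
    exact hnot (hxy ▸ Relation.ReflTransGen.refl)

end Blocks

end PlaneGraph

open PlaneGraph in
/-- Every block of a weak near-triangulation is either a near-triangulation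
or a `K₂` (a block consisting of a single edge). -/
theorem block_of_WNT (G : PlaneGraph) (hG : G.IsWNT)
    (B : Set (ℝ × ℝ)) (hB : G.IsBlock B) :
    (G.induce B).IsNearTriangulation ∨ ∃ u v, u ≠ v ∧ G.Adj u v ∧ B = {u, v} := by
  have hverts : (G.induce B).verts = B := inter_eq_right.2 hB.1
  have hfin : B.Finite := G.finite_verts.subset hB.1
  have hBne : B.Nonempty := hverts ▸ hB.2.1.1
  by_cases h3 : 3 ≤ B.ncard
  · exact Or.inl ⟨⟨hB.2.1, by rwa [hverts], hB.2.2.1⟩, fun F hF hb =>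
      isTriangularFace_induce hG.1
        (fun a ha b hb c hab hac hbc => hB.mem_of_adj_of_adj ha hb hab hac hbc) hF hb⟩
  · right
    have hpos : 0 < B.ncard := (ncard_pos hfin).2 hBne
    obtain h1 | h2 : B.ncard = 1 ∨ B.ncard = 2 := by omega
    · obtain ⟨v, rfl⟩ := ncard_eq_one.1 h1
      obtain ⟨b, c, ht⟩ := hG.2 v (hB.1 rfl)
      exact absurd rfl (hB.ne_singleton ht.2.2.2.1)
    · obtain ⟨u, v, huv, rfl⟩ := ncard_eq_two.1 h2
      refine ⟨u, v, huv, ?_, rfl⟩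
      have hr : (G.induce {u, v}).Reachable u v :=
        hB.2.1.2 u (by simp [hverts]) v (by simp [hverts])
      rcases Relation.ReflTransGen.cases_head hr with h | ⟨w, h, -⟩
      · exact absurd h huv
      · rcases h.2.2 with rfl | rfl
        · exact absurd h.1 (G.adj_irrefl _)
        · exact h.1
end

section
/- Every weak near-triangulation on n vertices has domination number at most n/3. -/
open Set

/-- A family of two-element subsets of a finite set `C`, indexed by a finite set `I`, has a
transversal of size at most `(|C| + |I|) / 3`. -/
theorem exists_transversal_of_card_eq_two {α ι : Type*} [DecidableEq α] (e : ι → Finset α)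
    (he : ∀ i, (e i).card = 2) (C : Finset α) (I : Finset ι) (hC : ∀ i ∈ I, e i ⊆ C) :
    ∃ D ⊆ C, (∀ i ∈ I, ∃ d ∈ D, d ∈ e i) ∧ 3 * D.card ≤ C.card + I.card := by
  classical
  induction C using Finset.strongInduction generalizing I with
  | H C ih =>
  by_cases h : ∃ v ∈ C, 2 ≤ (I.filter (v ∈ e ·)).card
  · obtain ⟨v, hv, hdeg⟩ := h
    obtain ⟨D, hDC, hD, hcard⟩ := ih (C.erase v) (Finset.erase_ssubset hv) (I.filter (v ∉ e ·))
      fun i hi x hx => by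
        rw [Finset.mem_filter] at hi
        exact Finset.mem_erase.2 ⟨fun hxv => hi.2 (hxv ▸ hx), hC i hi.1 hx⟩
    refine ⟨insert v D, ?_, fun i hi => ?_, ?_⟩
    · exact Finset.insert_subset hv (hDC.trans (Finset.erase_subset _ _))
    · by_cases hvi : v ∈ e i
      · exact ⟨v, Finset.mem_insert_self _ _, hvi⟩
      · obtain ⟨d, hd, hdi⟩ := hD i (Finset.mem_filter.2 ⟨hi, hvi⟩)
        exact ⟨d, Finset.mem_insert_of_mem hd, hdi⟩
    · have h₁ := Finset.card_filter_add_card_filter_not (s := I) (v ∈ e ·)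
      have h₂ := Finset.card_insert_le v D
      have h₃ := Finset.card_erase_add_one hv
      omega
  · push Not at h
    have hne : ∀ i, ∃ x, x ∈ e i := fun i => Finset.card_pos.1 (by rw [he]; norm_num)
    choose x hx using hne
    have hdisj : (I : Set ι).PairwiseDisjoint e := by
      intro i hi j hj hij
      refine Finset.disjoint_left.2 fun v hvi hvj => ?_
      have hlt : 1 < (I.filter (v ∈ e ·)).card :=
        Finset.one_lt_card.2 ⟨i, Finset.mem_filter.2 ⟨hi, hvi⟩, j, Finset.mem_filter.2 ⟨hj, hvj⟩, hij⟩
      have := h v (hC i hi hvi)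
      omega
    refine ⟨I.image x, Finset.image_subset_iff.2 fun i hi => hC i hi (hx i),
      fun i hi => ⟨x i, Finset.mem_image_of_mem x hi, hx i⟩, ?_⟩
    have h₁ : (I.biUnion e).card = I.card * 2 := by
      rw [Finset.card_biUnion hdisj, Finset.sum_const_nat fun i _ => he i]
    have h₂ := Finset.card_le_card (Finset.biUnion_subset.2 hC)
    have h₃ := Finset.card_image_le (s := I) (f := x)
    omega

/-- If three-element subsets of a finite set `V` cover `V`, then some of them already cover `V` and
have a common transversal of size at most `|V| / 3`. -/
theorem exists_cover_with_transversal {α : Type*} [DecidableEq α] (V : Finset α)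
    (F : Finset (Finset α)) (hF : ∀ t ∈ F, t ⊆ V ∧ t.card = 3) (hcov : ∀ v ∈ V, ∃ t ∈ F, v ∈ t) :
    ∃ F' ⊆ F, (∀ v ∈ V, ∃ t ∈ F', v ∈ t) ∧
      ∃ D ⊆ V, (∀ t ∈ F', ∃ d ∈ D, d ∈ t) ∧ 3 * D.card ≤ V.card := by
  induction F using Finset.strongInduction with
  | H F ih =>
  by_cases h : ∃ t ∈ F, ∀ v ∈ V, ∃ s ∈ F.erase t, v ∈ s
  · obtain ⟨t, ht, hcov'⟩ := h
    obtain ⟨F', hF', h'⟩ := ih (F.erase t) (Finset.erase_ssubset ht)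
      (fun s hs => hF s (Finset.mem_of_mem_erase hs)) hcov'
    exact ⟨F', hF'.trans (Finset.erase_subset _ _), h'⟩
  · push Not at h
    have hpriv : ∀ t : F, ∃ v ∈ V, v ∈ t.1 ∧ ∀ s ∈ F, v ∈ s → s = t.1 := by
      rintro ⟨t, ht⟩
      obtain ⟨v, hv, hvt⟩ := h t ht
      have key : ∀ s ∈ F, v ∈ s → s = t := fun s hs hvs => by
        by_contra hst
        exact hvt s (Finset.mem_erase.2 ⟨hst, hs⟩) hvs
      obtain ⟨s, hs, hvs⟩ := hcov v hv
      exact ⟨v, hv, key s hs hvs ▸ hvs, key⟩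
    choose p hpV hpt hp using hpriv
    have hinj : Function.Injective p := fun s t hst =>
      Subtype.ext (hp t s s.2 (hst ▸ hpt s))
    have hcard : (F.attach.image p).card = F.card := by
      rw [Finset.card_image_of_injective _ hinj, Finset.card_attach]
    have hsub : F.attach.image p ⊆ V := Finset.image_subset_iff.2 fun t _ => hpV t
    obtain ⟨D, hDC, hD, hDcard⟩ := exists_transversal_of_card_eq_two
      (fun t : F => t.1.erase (p t))
      (fun t => by rw [Finset.card_erase_of_mem (hpt t), (hF t t.2).2])
      (V \ F.attach.image p) F.attach fun t _ x hx => by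
        rw [Finset.mem_erase] at hx
        refine Finset.mem_sdiff.2 ⟨(hF t t.2).1 hx.2, fun hxp => ?_⟩
        obtain ⟨s, -, rfl⟩ := Finset.mem_image.1 hxp
        exact hx.1 (congrArg p (Subtype.ext (hp s t t.2 hx.2))).symm
    refine ⟨F, subset_rfl, hcov, D, hDC.trans Finset.sdiff_subset, fun t ht => ?_, ?_⟩
    · obtain ⟨d, hd, hdt⟩ := hD ⟨t, ht⟩ (Finset.mem_attach _ _)
      exact ⟨d, hd, Finset.mem_of_mem_erase hdt⟩
    · rw [Finset.card_attach] at hDcard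
      have := Finset.card_sdiff_add_card_eq_card hsub
      omega

namespace PlaneGraph

/-- If every vertex lies in a triangle, then some dominating set contains at most a third of the
vertices. -/
theorem exists_isDominatingSet_of_inTriangle (G : PlaneGraph)
    (hG : ∀ v ∈ G.verts, G.InTriangle v) :
    ∃ D, G.IsDominatingSet D ∧ 3 * D.ncard ≤ G.verts.ncard := by
  classical
  set V := G.finite_verts.toFinset
  have hmem : ∀ v, v ∈ V ↔ v ∈ G.verts := fun v => G.finite_verts.mem_toFinset
  obtain ⟨F', hF', hcov, D, hDV, hD, hcard⟩ := exists_cover_with_transversal V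
    (V.powerset.filter fun t => t.card = 3 ∧ ∀ x ∈ t, ∀ y ∈ t, x ≠ y → G.Adj x y)
    (fun t ht => by
      rw [Finset.mem_filter, Finset.mem_powerset] at ht
      exact ⟨ht.1, ht.2.1⟩)
    (fun v hv => by
      obtain ⟨b, c, hvb, hvc, hbc, h₁, h₂, h₃⟩ := hG v ((hmem v).1 hv)
      have h₁' := G.adj_symm _ _ h₁
      have h₂' := G.adj_symm _ _ h₂
      have h₃' := G.adj_symm _ _ h₃
      refine ⟨{v, b, c}, Finset.mem_filter.2 ⟨Finset.mem_powerset.2 ?_,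
        Finset.card_eq_three.2 ⟨v, b, c, hvb, hvc, hbc, rfl⟩, ?_⟩, by simp⟩
      · intro x hx
        rw [hmem]
        simp only [Finset.mem_insert, Finset.mem_singleton] at hx
        rcases hx with rfl | rfl | rfl
        exacts [G.adj_mem _ _ h₁, G.adj_mem _ _ h₂, G.adj_mem _ _ h₂']
      · simp only [Finset.mem_insert, Finset.mem_singleton]
        rintro x (rfl | rfl | rfl) y (rfl | rfl | rfl) hxy <;>
          first | exact absurd rfl hxy | assumption)
  refine ⟨D, ⟨fun d hd => (hmem d).1 (hDV hd), fun v hv hvD => ?_⟩, ?_⟩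
  · obtain ⟨t, ht, hvt⟩ := hcov v ((hmem v).2 hv)
    obtain ⟨d, hd, hdt⟩ := hD t ht
    exact ⟨d, hd, (Finset.mem_filter.1 (hF' ht)).2.2 v hvt d hdt fun hvd => hvD (hvd ▸ hd)⟩
  · rwa [Set.ncard_coe_finset, Set.ncard_eq_toFinset_card _ G.finite_verts]

end PlaneGraph

open PlaneGraph in
/-- Every weak near-triangulation on `n` vertices has domination number at most `n/3`. -/
theorem WNT_domination_number_le (G : PlaneGraph) (hG : G.IsWNT) :
    (G.dominationNumber : ℝ) ≤ (G.verts.ncard : ℝ) / 3 := by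
  obtain ⟨D, hD, hcard⟩ := G.exists_isDominatingSet_of_inTriangle hG.2
  have hle : G.dominationNumber ≤ D.ncard := Nat.sInf_le ⟨D, hD, rfl⟩
  rw [le_div_iff₀ three_pos]
  exact_mod_cast (by omega : G.dominationNumber * 3 ≤ G.verts.ncard)
end
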